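/- arXiv:1903.07174 — 2 statements merged into one kernel-verified Lean document; each statement's English description precedes it below -/
import Mathlib

section
/- Let I, J be finite index sets and, for i ∈ I and j ∈ J, let H_i ∈ ℝ^{p_i×r_i}, h_i ∈ ℝ^{p_i}, G_j ∈ ℝ^{q_j×n_j}, g_j ∈ ℝ^{q_j}, and suppose each polyhedron {w ∈ ℝ^{n_j} : G_j w ≤ g_j} is nonempty. Let Φ^{i,j} ∈ ℝ^{r_i×n_j} and λ^{i,j} ∈ ℝ^{p_i×q_j} be block matrices such that every λ^{i,j} has nonnegative entries, H_i Φ^{i,j} = λ^{i,j} G_j for all i, j, and ∑_{j∈J} λ^{i,j} g_j ≤ h_i (entrywise) for all i. Let Z ⊆ I×J be any set of blocks on which Φ vanishes, i.e. Φ^{i,j} = 0 for all (i,j) ∈ Z, and define λ'^{i,j} = 0 for (i,j) ∈ Z and λ'^{i,j} = λ^{i,j} otherwise. Then every λ'^{i,j} has nonnegative entries, H_i Φ^{i,j} = λ'^{i,j} G_j for all i, j, and ∑_{j∈J} λ'^{i,j} g_j ≤ ∑_{j∈J} λ^{i,j} g_j ≤ h_i (entrywise) for all i. -/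
open Matrix

/-- Easy direction of the Farkas lemma: a nonnegative `L` with `L * G = 0` maps the right-hand side
of a feasible system `G *ᵥ w ≤ g` to a nonnegative vector. -/
theorem Matrix.mulVec_nonneg_of_mul_eq_zero {l m n R : Type*} [Fintype m] [Fintype n]
    [Ring R] [PartialOrder R] [IsOrderedRing R] {L : Matrix l m R} {G : Matrix m n R}
    {g : m → R} {w : n → R} (hL : ∀ a b, 0 ≤ L a b) (hLG : L * G = 0) (hw : G *ᵥ w ≤ g) :
    0 ≤ L *ᵥ g :=
  calc 0 = L *ᵥ (G *ᵥ w) := by rw [mulVec_mulVec, hLG, zero_mulVec]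
    _ ≤ L *ᵥ g := fun a ↦
      Finset.sum_le_sum fun b _ ↦ mul_le_mul_of_nonneg_left (hw b) (hL a b)

/-- The paper's Theorem 1 (sparsity of the dual variable): with decoupled
block-diagonal performance constraints `(H_i, h_i)` and disturbance
constraints `(G_j, g_j)` (each polyhedron `{w : G_j w ≤ g_j}` nonempty), given
a feasible nonnegative dual variable `lam` with `H_i Φ^{i,j} = lam^{i,j} G_j`
and `∑_j lam^{i,j} g_j ≤ h_i`, zeroing the blocks of `lam` corresponding to a
set `Z` of zero blocks of `Φ` preserves feasibility.  All vector and matrix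
inequalities are entrywise. -/
theorem dual_variable_sparsity
    (I J : Type*) [Fintype I] [Fintype J]
    (p r : I → ℕ) (q n : J → ℕ)
    (H : (i : I) → Matrix (Fin (p i)) (Fin (r i)) ℝ)
    (h : (i : I) → Fin (p i) → ℝ)
    (G : (j : J) → Matrix (Fin (q j)) (Fin (n j)) ℝ)
    (g : (j : J) → Fin (q j) → ℝ)
    (hne : ∀ j : J, ∃ w : Fin (n j) → ℝ, G j *ᵥ w ≤ g j)
    (Φ : (i : I) → (j : J) → Matrix (Fin (r i)) (Fin (n j)) ℝ)
    (lam : (i : I) → (j : J) → Matrix (Fin (p i)) (Fin (q j)) ℝ)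
    (hlam : ∀ i j, ∀ a b, 0 ≤ lam i j a b)
    (heq : ∀ i j, H i * Φ i j = lam i j * G j)
    (hineq : ∀ i, (∑ j : J, lam i j *ᵥ g j) ≤ h i)
    (Z : Set (I × J)) [DecidablePred (· ∈ Z)]
    (hZ : ∀ x ∈ Z, Φ x.1 x.2 = 0)
    (lam' : (i : I) → (j : J) → Matrix (Fin (p i)) (Fin (q j)) ℝ)
    (hlam' : ∀ i j, lam' i j = if (i, j) ∈ Z then 0 else lam i j) :
    (∀ i j, ∀ a b, 0 ≤ lam' i j a b) ∧
    (∀ i j, H i * Φ i j = lam' i j * G j) ∧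
    (∀ i, (∑ j : J, lam' i j *ᵥ g j) ≤ ∑ j : J, lam i j *ᵥ g j) ∧
    (∀ i, (∑ j : J, lam' i j *ᵥ g j) ≤ h i) := by
  have hle : ∀ i, (∑ j : J, lam' i j *ᵥ g j) ≤ ∑ j : J, lam i j *ᵥ g j := by
    refine fun i ↦ Finset.sum_le_sum fun j _ ↦ ?_
    rw [hlam']
    split_ifs with hij
    · obtain ⟨w, hw⟩ := hne j
      rw [zero_mulVec]
      refine mulVec_nonneg_of_mul_eq_zero (hlam i j) ?_ hw
      rw [← heq, hZ _ hij, Matrix.mul_zero]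
    · exact le_rfl
  refine ⟨fun i j a b ↦ ?_, fun i j ↦ ?_, hle, fun i ↦ (hle i).trans (hineq i)⟩
  · rw [hlam']
    split_ifs
    · exact le_rfl
    · exact hlam i j a b
  · rw [hlam']
    split_ifs with hij
    · rw [hZ _ hij, Matrix.mul_zero, Matrix.zero_mul]
    · exact heq i j
end

section
/- Let K = RatFunc ℝ be the field of real rational functions with indeterminate z, and let A ∈ ℝ^{n×n}, B ∈ ℝ^{n×m} be real matrices, regarded as matrices over K. Let Φx be an n×n matrix and Φu an m×n matrix over K satisfying (z·I − A)·Φx − B·Φu = I, with z·I − A and Φx invertible over K. Let x ∈ K^n and u ∈ K^m be (column) vectors satisfying u + Φu·B·u = Φu·(z·I − A)·x. Then B·u = B·Φu·Φx^{−1}·x. -/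
open Matrix

set_option synthInstance.maxHeartbeats 1000000
set_option maxHeartbeats 1000000

/-- If `M * P - B * F = 1` with `M` and `P` invertible, then `u + F B u = F M x` forces
`B u = B F P⁻¹ x`. -/
theorem Matrix.mulVec_eq_of_mul_sub_mul_eq_one {R n m : Type*} [CommRing R]
    [Fintype n] [DecidableEq n] [Fintype m]
    {M P : Matrix n n R} {B : Matrix n m R} {F : Matrix m n R}
    (h : M * P - B * F = 1) (hM : IsUnit M.det) (hP : IsUnit P.det)
    {x : n → R} {u : m → R} (hu : u + (F * B) *ᵥ u = (F * M) *ᵥ x) :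
    B *ᵥ u = (B * F * P⁻¹) *ᵥ x := by
  have hMP : M * P = 1 + B * F := sub_eq_iff_eq_add.mp h
  have hunit : IsUnit (M * P) := by
    rw [isUnit_iff_isUnit_det, det_mul]
    exact hM.mul hP
  have hcancel : M * P * (B * F * P⁻¹) = B * (F * M) := by
    calc M * P * (B * F * P⁻¹) = B * F * (1 + B * F) * P⁻¹ := by
          rw [hMP]
          simp only [Matrix.add_mul, Matrix.mul_add, Matrix.one_mul, Matrix.mul_one,
            Matrix.mul_assoc]
      _ = B * (F * M) := by
          rw [← hMP, ← Matrix.mul_assoc, mul_nonsing_inv_cancel_right _ _ hP, Matrix.mul_assoc]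
  apply mulVec_injective_of_isUnit hunit
  calc (M * P) *ᵥ (B *ᵥ u) = B *ᵥ (u + (F * B) *ᵥ u) := by
        rw [hMP, add_mulVec, one_mulVec, mulVec_add, mulVec_mulVec, mulVec_mulVec,
          Matrix.mul_assoc]
    _ = (M * P) *ᵥ ((B * F * P⁻¹) *ᵥ x) := by
        rw [hu, mulVec_mulVec, mulVec_mulVec, hcancel]

/-- Algebraic core of part (ii) of the paper's Theorem 2: under the SLS affine
constraint `(zI − A) Φx − B Φu = I` (with `zI − A` and `Φx` invertible over the
field of real rational functions), the IMC relation
`u + Φu B u = Φu (zI − A) x` implies `B u = B Φu Φx⁻¹ x`, i.e. the block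
diagram realizes the SLS controller. -/
theorem imc_realizes_sls_controller
    (nn mm : ℕ)
    (A : Matrix (Fin nn) (Fin nn) ℝ) (B : Matrix (Fin nn) (Fin mm) ℝ)
    (Φx : Matrix (Fin nn) (Fin nn) (RatFunc ℝ))
    (Φu : Matrix (Fin mm) (Fin nn) (RatFunc ℝ))
    (hconstr :
      ((RatFunc.X : RatFunc ℝ) • (1 : Matrix (Fin nn) (Fin nn) (RatFunc ℝ))
          - A.map (algebraMap ℝ (RatFunc ℝ))) * Φx
        - B.map (algebraMap ℝ (RatFunc ℝ)) * Φu = 1)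
    (hzA : IsUnit ((RatFunc.X : RatFunc ℝ) • (1 : Matrix (Fin nn) (Fin nn) (RatFunc ℝ))
          - A.map (algebraMap ℝ (RatFunc ℝ))).det)
    (hΦx : IsUnit Φx.det)
    (x : Fin nn → RatFunc ℝ) (u : Fin mm → RatFunc ℝ)
    (hu : u + (Φu * B.map (algebraMap ℝ (RatFunc ℝ))) *ᵥ u
        = (Φu * ((RatFunc.X : RatFunc ℝ) • (1 : Matrix (Fin nn) (Fin nn) (RatFunc ℝ))
            - A.map (algebraMap ℝ (RatFunc ℝ)))) *ᵥ x) :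
    B.map (algebraMap ℝ (RatFunc ℝ)) *ᵥ u
      = (B.map (algebraMap ℝ (RatFunc ℝ)) * Φu * Φx⁻¹) *ᵥ x := by
  exact mulVec_eq_of_mul_sub_mul_eq_one hconstr hzA hΦx hu
end
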